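/- arXiv:2511.12505 — 2 statements merged into one kernel-verified Lean document; each statement's English description precedes it below -/
import Mathlib

section
/- For every integer n ≥ 3, every star-colouring of K_n containing no rainbow triangle is a lexical colouring (with respect to some ordering of the vertices), and consequently ar*(n, K_3) = n - 1. -/
open SimpleGraph

/-- An edge-colouring of the complete graph on `α` (only values on
non-diagonal pairs are relevant). -/
abbrev EdgeColouring (α : Type*) := Sym2 α → ℕ

/-- A star-colouring: every colour class is a star, i.e. any two edges of the
same colour share a vertex, and no colour class contains a triangle. -/
def IsStarColouring {α : Type*} (c : EdgeColouring α) : Prop :=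
  (∀ a b x y : α, a ≠ b → x ≠ y → c s(a, b) = c s(x, y) →
      a = x ∨ a = y ∨ b = x ∨ b = y) ∧
  ∀ a b d : α, a ≠ b → b ≠ d → a ≠ d →
      ¬(c s(a, b) = c s(b, d) ∧ c s(b, d) = c s(a, d))

/-- The number of colours used on the edges of the complete graph on `α`. -/
noncomputable def colourCount {α : Type*} (c : EdgeColouring α) : ℕ :=
  (c '' {e : Sym2 α | ¬ e.IsDiag}).ncard

/-- The colouring `c` of the complete graph on `α` contains a rainbow copy of
the graph `H`: there is an injection of `V(H)` such that distinct edges of `H`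
receive distinct colours. -/
def HasRainbowCopy {α β : Type*} (c : EdgeColouring α) (H : SimpleGraph β) : Prop :=
  ∃ f : β ↪ α, ∀ u v x y : β, H.Adj u v → H.Adj x y → s(u, v) ≠ s(x, y) →
    c s(f u, f v) ≠ c s(f x, f y)

/-- The star-anti-Ramsey number `ar*(n, H)`: the maximum number of colours in a
star-colouring of `K_n` with no rainbow copy of `H`. -/
noncomputable def starAntiRamsey (n : ℕ) {β : Type*} (H : SimpleGraph β) : ℕ :=
  sSup {s | ∃ c : EdgeColouring (Fin n), IsStarColouring c ∧ colourCount c = s ∧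
    ¬ HasRainbowCopy c H}

/-- The lexical colouring of `K_n`: the edge `{i, j}` with `i < j` gets colour `i`. -/
def lexColouring (n : ℕ) : EdgeColouring (Fin n) :=
  Sym2.lift ⟨fun i j => min i.1 j.1, fun i j => by simp [min_comm]⟩

/-- `c` is a lexical colouring with respect to some ordering of the vertices. -/
def IsLexical {n : ℕ} (c : EdgeColouring (Fin n)) : Prop :=
  ∃ v : Fin n ≃ Fin n, ∀ i j i' j' : Fin n, i < j → i' < j' →
    (c s(v i, v j) = c s(v i', v j') ↔ i = i')

/-- `v` is a centre of the colour class of colour `m`: the class is nonempty and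
every edge of colour `m` is incident to `v` (for star-colourings this is exactly
a vertex of maximum degree in the class). -/
def IsCentre {α : Type*} (c : EdgeColouring α) (v : α) (m : ℕ) : Prop :=
  (∃ e : Sym2 α, ¬ e.IsDiag ∧ c e = m ∧ v ∈ e) ∧
  ∀ e : Sym2 α, ¬ e.IsDiag → c e = m → v ∈ e

/-- `G` contains a copy of `F` as a subgraph. -/
def ContainsCopy {α β : Type*} (F : SimpleGraph α) (G : SimpleGraph β) : Prop :=
  ∃ f : α ↪ β, ∀ u v, F.Adj u v → G.Adj (f u) (f v)

/-- The extremal (Turán) number `ex(n, F)`. -/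
noncomputable def extremalNumber (n : ℕ) {α : Type*} (F : SimpleGraph α) : ℕ :=
  sSup {m | ∃ G : SimpleGraph (Fin n), ¬ ContainsCopy F G ∧ G.edgeSet.ncard = m}

/-- The join of two graphs: vertex-disjoint copies of `G` and `H` together with
all edges between them. -/
def graphJoin {α β : Type*} (G : SimpleGraph α) (H : SimpleGraph β) :
    SimpleGraph (α ⊕ β) :=
  SimpleGraph.fromRel (fun x y => match x, y with
    | Sum.inl a, Sum.inl b => G.Adj a b
    | Sum.inr a, Sum.inr b => H.Adj a b
    | Sum.inl _, Sum.inr _ => True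
    | Sum.inr _, Sum.inl _ => False)

/-- The complete bipartite graph `K_{s,t}` minus one edge. -/
def Kstminus (s t : ℕ) (hs : 0 < s) (ht : 0 < t) : SimpleGraph (Fin s ⊕ Fin t) :=
  (completeBipartiteGraph (Fin s) (Fin t)).deleteEdges
    {s(Sum.inl ⟨0, hs⟩, Sum.inr ⟨0, ht⟩)}

/-- Without a rainbow triangle, every triangle has two edges of the same colour. -/
theorem exists_eq_of_not_hasRainbowCopy {α : Type*} {c : EdgeColouring α}
    (h : ¬ HasRainbowCopy c (⊤ : SimpleGraph (Fin 3))) {a b d : α}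
    (hab : a ≠ b) (hbd : b ≠ d) (had : a ≠ d) :
    c s(a, b) = c s(b, d) ∨ c s(b, d) = c s(a, d) ∨ c s(a, b) = c s(a, d) := by
  by_contra! hne
  obtain ⟨h1, h2, h3⟩ := hne
  refine h ⟨⟨![a, b, d], ?_⟩, ?_⟩
  · intro i j hij
    fin_cases i <;> fin_cases j <;> simp_all
  · intro u v x y huv hxy hne
    have hba : s(b, a) = s(a, b) := Sym2.eq_swap
    have hdb : s(d, b) = s(b, d) := Sym2.eq_swap
    have hda : s(d, a) = s(a, d) := Sym2.eq_swap
    fin_cases u <;> fin_cases v <;> simp at huv <;> fin_cases x <;> fin_cases y <;>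
      simp at hxy hne <;>
      simp [DFunLike.coe, hba, hdb, hda, h1, h2, h3, h1.symm, h2.symm, h3.symm]

/-- Restricting the colouring along an embedding keeps it free of rainbow copies. -/
theorem HasRainbowCopy.of_comp_map {α β γ : Type*} {c : EdgeColouring α} {H : SimpleGraph γ}
    (e : β ↪ α) (h : HasRainbowCopy (c ∘ Sym2.map e) H) : HasRainbowCopy c H := by
  obtain ⟨f, hf⟩ := h
  exact ⟨f.trans e, fun u v x y huv hxy hne => by simpa using hf u v x y huv hxy hne⟩

/-- The restriction of a star-colouring along an embedding is a star-colouring. -/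
theorem IsStarColouring.comp_map {α β : Type*} {c : EdgeColouring α} (hc : IsStarColouring c)
    (e : β ↪ α) : IsStarColouring (c ∘ Sym2.map e) := by
  refine ⟨fun a b x y hab hxy h => ?_, fun a b d hab hbd had h => ?_⟩
  · simpa using hc.1 (e a) (e b) (e x) (e y) (by simpa) (by simpa) (by simpa using h)
  · exact hc.2 (e a) (e b) (e d) (by simpa) (by simpa) (by simpa) (by simpa using h)

/-- In a star-colouring of a complete graph without rainbow triangles, some vertex has all its
edges of the same colour. -/
theorem IsStarColouring.exists_monochromatic_vertex {α : Type*} [Fintype α] [Nontrivial α]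
    {c : EdgeColouring α} (hc : IsStarColouring c)
    (h : ¬ HasRainbowCopy c (⊤ : SimpleGraph (Fin 3))) :
    ∃ v : α, ∀ x y, x ≠ v → y ≠ v → c s(v, x) = c s(v, y) := by
  classical
  let L : α × α → Finset α := fun p => {y | y ≠ p.1 ∧ c s(p.1, y) = c s(p.1, p.2)}
  obtain ⟨a, b, hab⟩ := exists_pair_ne α
  obtain ⟨⟨v, x⟩, hvx, hmax⟩ := Finset.exists_max_image
    ({p | p.1 ≠ p.2} : Finset (α × α)) (fun p => (L p).card) ⟨(a, b), by simpa using hab⟩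
  replace hvx : v ≠ x := by simpa using hvx
  replace hmax : ∀ u w, u ≠ w → (L (u, w)).card ≤ (L (v, x)).card := fun u w huw =>
    hmax (u, w) (by simpa using huw)
  have hmem : ∀ u w y, y ∈ L (u, w) ↔ y ≠ u ∧ c s(u, y) = c s(u, w) := by simp [L]
  suffices hall : ∀ u, u ≠ v → c s(v, u) = c s(v, x) from
    ⟨v, fun y z hy hz => (hall y hy).trans (hall z hz).symm⟩
  intro u huv
  by_contra hne
  by_cases hcase : ∃ l ∈ L (v, x), c s(u, l) = c s(v, x)
  · obtain ⟨l, hl, hul⟩ := hcase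
    rw [hmem] at hl
    have hlu : u ≠ l := by rintro rfl; exact hne hl.2
    have hL : L (v, x) ⊆ {l} := by
      intro l' hl'
      rw [hmem] at hl'
      have hul' : u ≠ l' := by rintro rfl; exact hne hl'.2
      rcases hc.1 u l v l' hlu hl'.1.symm (hul.trans hl'.2.symm) with h1 | h1 | h1 | h1
      · exact absurd h1 huv
      · exact absurd h1 hul'
      · exact absurd h1 hl.1
      · simp [h1]
    have hL' : ({v, u} : Finset α) ⊆ L (l, v) := by
      intro w hw
      rw [hmem]
      rcases Finset.mem_insert.1 hw with rfl | hw
      · exact ⟨hl.1.symm, rfl⟩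
      · obtain rfl := Finset.mem_singleton.1 hw
        refine ⟨hlu, ?_⟩
        rw [Sym2.eq_swap, hul, ← hl.2, Sym2.eq_swap]
    have h1 := Finset.card_le_card hL
    have h2 := Finset.card_le_card hL'
    have h3 := hmax l v hl.1
    rw [Finset.card_pair huv.symm] at h2
    rw [Finset.card_singleton] at h1
    omega
  · push Not at hcase
    have hsub : insert v (L (v, x)) ⊆ L (u, v) := by
      intro w hw
      rw [hmem]
      rcases Finset.mem_insert.1 hw with rfl | hw
      · exact ⟨huv.symm, rfl⟩
      · have hw' := hcase w hw
        rw [hmem] at hw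
        have huw : u ≠ w := by rintro rfl; exact hne hw.2
        refine ⟨huw.symm, ?_⟩
        rw [Sym2.eq_swap (a := u) (b := v)]
        rcases exists_eq_of_not_hasRainbowCopy h huv.symm huw hw.1.symm with h1 | h1 | h1
        · exact h1.symm
        · exact absurd (h1.trans hw.2) hw'
        · exact absurd (h1.trans hw.2) hne
    have h1 := Finset.card_le_card hsub
    rw [Finset.card_insert_of_notMem (by simp [hmem])] at h1
    have h2 := hmax u v huv
    omega

/-- In a star-colouring, if all edges at `v` have the same colour, then that colour does not
appear on edges avoiding `v`. -/
theorem IsStarColouring.ne_of_monochromatic_vertex {α : Type*} {c : EdgeColouring α}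
    (hc : IsStarColouring c) {v : α} (hv : ∀ x y, x ≠ v → y ≠ v → c s(v, x) = c s(v, y))
    {x y z : α} (hx : x ≠ v) (hy : y ≠ v) (hz : z ≠ v) (hyz : y ≠ z) :
    c s(v, x) ≠ c s(y, z) := by
  intro h
  exact hc.2 v y z hy.symm hyz hz.symm ⟨(hv y x hy hx).trans h, h.symm.trans (hv x z hx hz)⟩

/-- A star-colouring without rainbow triangles is lexical. -/
theorem IsStarColouring.isLexical {n : ℕ} {c : EdgeColouring (Fin n)} (hc : IsStarColouring c)
    (h : ¬ HasRainbowCopy c (⊤ : SimpleGraph (Fin 3))) : IsLexical c := by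
  induction n with
  | zero => exact ⟨Equiv.refl _, fun i => i.elim0⟩
  | succ n ih =>
    rcases Nat.eq_zero_or_pos n with rfl | hn
    · exact ⟨Equiv.refl _, fun i j i' j' _ _ => by omega⟩
    have : Nontrivial (Fin (n + 1)) := Fin.nontrivial_iff_two_le.2 (by omega)
    obtain ⟨v, hv⟩ := hc.exists_monochromatic_vertex h
    obtain ⟨w, hw⟩ := ih (hc.comp_map (Fin.succAboveEmb v))
      (fun h' => h (h'.of_comp_map _))
    let f : Fin (n + 1) → Fin (n + 1) := Fin.cons v (v.succAbove ∘ w)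
    have hf : Function.Injective f := by
      refine Fin.cons_injective_iff.2 ⟨?_, Fin.succAbove_right_injective.comp w.injective⟩
      rintro ⟨i, hi⟩
      exact Fin.succAbove_ne _ _ hi
    refine ⟨Equiv.ofBijective f (Finite.injective_iff_bijective.1 hf), ?_⟩
    intro i j i' j' hij hij'
    simp only [Equiv.ofBijective_apply]
    obtain ⟨j, rfl⟩ := Fin.exists_succ_eq.2 (Fin.ne_zero_of_lt hij)
    obtain ⟨j', rfl⟩ := Fin.exists_succ_eq.2 (Fin.ne_zero_of_lt hij')
    have hne : ∀ k, v.succAbove k ≠ v := Fin.succAbove_ne v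
    rcases Fin.eq_zero_or_eq_succ i with rfl | ⟨i, rfl⟩ <;>
      rcases Fin.eq_zero_or_eq_succ i' with rfl | ⟨i', rfl⟩
    · simpa [f] using hv _ _ (hne _) (hne _)
    · have hij' := (Fin.succ_lt_succ_iff.1 hij').ne
      simpa [f, (Fin.succ_ne_zero i').symm] using
        hc.ne_of_monochromatic_vertex hv (hne (w j)) (hne (w i')) (hne (w j')) (by simpa)
    · have hij := (Fin.succ_lt_succ_iff.1 hij).ne
      simpa [f, Fin.succ_ne_zero i] using
        (hc.ne_of_monochromatic_vertex hv (hne (w j')) (hne (w i)) (hne (w j)) (by simpa)).symm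
    · simpa [f] using hw i j i' j' (Fin.succ_lt_succ_iff.1 hij) (Fin.succ_lt_succ_iff.1 hij')

/-- A lexical colouring of `K_{n+1}` uses exactly `n` colours. -/
theorem IsLexical.colourCount_eq {n : ℕ} {c : EdgeColouring (Fin (n + 1))} (hc : IsLexical c) :
    colourCount c = n := by
  obtain ⟨v, hv⟩ := hc
  let g : Fin n → ℕ := fun i => c s(v i.castSucc, v (Fin.last n))
  have hg : Function.Injective g := fun i i' h => Fin.castSucc_injective n <|
    (hv _ _ _ _ (Fin.castSucc_lt_last i) (Fin.castSucc_lt_last i')).1 h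
  have key : ∀ i j, i < j → c s(v i, v j) ∈ Set.range g := fun i j hij =>
    ⟨i.castPred (Fin.ne_last_of_lt hij), by
      simp only [g, Fin.castSucc_castPred]
      exact (hv _ _ _ _ (hij.trans_le (Fin.le_last j)) hij).2 rfl⟩
  have himage : c '' {e : Sym2 (Fin (n + 1)) | ¬ e.IsDiag} = Set.range g := by
    ext m
    constructor
    · rintro ⟨e, he, rfl⟩
      induction e using Sym2.ind with
      | _ x y =>
        obtain ⟨i, rfl⟩ := v.surjective x
        obtain ⟨j, rfl⟩ := v.surjective y
        have hne : i ≠ j := by rintro rfl; simp at he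
        rcases hne.lt_or_gt with hij | hij
        · exact key i j hij
        · rw [Sym2.eq_swap]
          exact key j i hij
    · rintro ⟨i, rfl⟩
      exact ⟨_, by simp, rfl⟩
  rw [colourCount, himage, ← Nat.card_coe_set_eq, Nat.card_range_of_injective hg, Nat.card_fin]

theorem lexColouring_mk {n : ℕ} (i j : Fin n) : lexColouring n s(i, j) = min i.1 j.1 := rfl

theorem isStarColouring_lexColouring (n : ℕ) : IsStarColouring (lexColouring n) := by
  constructor
  · intro a b x y _ _ h
    simp only [lexColouring_mk] at h
    simp only [Fin.ext_iff]
    omega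
  · intro a b d hab hbd had h
    simp only [lexColouring_mk] at h
    simp only [ne_eq, Fin.ext_iff] at hab hbd had
    omega

theorem not_hasRainbowCopy_lexColouring (n : ℕ) :
    ¬ HasRainbowCopy (lexColouring n) (⊤ : SimpleGraph (Fin 3)) := by
  rintro ⟨f, hf⟩
  have h1 := hf 0 1 1 2 (by decide) (by decide) (by decide)
  have h2 := hf 0 1 0 2 (by decide) (by decide) (by decide)
  have h3 := hf 1 2 0 2 (by decide) (by decide) (by decide)
  simp only [lexColouring_mk] at h1 h2 h3
  omega

/-- For `n ≥ 3`, every rainbow-triangle-free star-colouring of `K_n` is lexical,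
and `ar*(n, K_3) = n - 1`. -/
theorem starAntiRamsey_K3 (n : ℕ) (hn : 3 ≤ n) :
    (∀ c : EdgeColouring (Fin n), IsStarColouring c →
      ¬ HasRainbowCopy c (⊤ : SimpleGraph (Fin 3)) → IsLexical c) ∧
    starAntiRamsey n (⊤ : SimpleGraph (Fin 3)) = n - 1 := by
  refine ⟨fun c hc h => hc.isLexical h, ?_⟩
  obtain ⟨m, rfl⟩ : ∃ m, n = m + 1 := ⟨n - 1, by omega⟩
  have hset : {s | ∃ c : EdgeColouring (Fin (m + 1)), IsStarColouring c ∧ colourCount c = s ∧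
      ¬ HasRainbowCopy c (⊤ : SimpleGraph (Fin 3))} = {m} := by
    ext s
    constructor
    · rintro ⟨c, hc, rfl, h⟩
      exact (hc.isLexical h).colourCount_eq
    · rintro rfl
      have hstar := isStarColouring_lexColouring (s + 1)
      have hfree := not_hasRainbowCopy_lexColouring (s + 1)
      exact ⟨_, hstar, (hstar.isLexical hfree).colourCount_eq, hfree⟩
  rw [starAntiRamsey, hset, csSup_singleton, Nat.add_sub_cancel]
end

section
/- Let H be a graph with minimum degree δ(H) ≥ 2 and let n ≥ v(H) be an integer, where v(H) is the number of vertices of H. Then ar*(n, H) ≥ C(v(H)-1, 2) + (δ(H) - 1)·(n - v(H) + 1), where C(m,2) denotes the binomial coefficient (m choose 2). -/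
open SimpleGraph

/-- The colouring of `K_n` in which the edge `{i, j}` with `i < j` is coloured by the pair
`(j, min i (f j - 1))`, so that each vertex `j` sends at most `f j` colours backwards. -/
def backwardColouring (n : ℕ) (f : ℕ → ℕ) : EdgeColouring (Fin n) :=
  Sym2.lift ⟨fun i j => Nat.pair (max i.1 j.1) (min (min i.1 j.1) (f (max i.1 j.1) - 1)),
    fun i j => by simp only [min_comm, max_comm]⟩

lemma backwardColouring_mk {n : ℕ} (f : ℕ → ℕ) (i j : Fin n) :
    backwardColouring n f s(i, j) =
      Nat.pair (max i.1 j.1) (min (min i.1 j.1) (f (max i.1 j.1) - 1)) := rfl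

lemma isStarColouring_backwardColouring (n : ℕ) (f : ℕ → ℕ) :
    IsStarColouring (backwardColouring n f) := by
  constructor
  · intro a b x y _ _ h
    simp only [backwardColouring_mk, Nat.pair_eq_pair] at h
    simp only [Fin.ext_iff]
    have := h.1
    omega
  · rintro a b d hab hbd had ⟨h₁, h₂⟩
    simp only [backwardColouring_mk, Nat.pair_eq_pair] at h₁ h₂
    simp only [ne_eq, Fin.ext_iff] at hab hbd had
    have := h₁.1
    have := h₂.1
    omega

lemma sum_le_colourCount_backwardColouring (n : ℕ) (f : ℕ → ℕ) (hf : ∀ j, f j ≤ j) :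
    ∑ j ∈ Finset.range n, f j ≤ colourCount (backwardColouring n f) := by
  classical
  have hcard : (((Finset.range n).sigma fun j => Finset.range (f j)).image
      fun x => Nat.pair x.1 x.2).card = ∑ j ∈ Finset.range n, f j := by
    rw [Finset.card_image_of_injective, Finset.card_sigma]
    · simp
    · rintro ⟨a, b⟩ ⟨a', b'⟩ h
      obtain ⟨rfl, rfl⟩ := Nat.pair_eq_pair.1 h
      rfl
  rw [← hcard, ← Set.ncard_coe_finset, colourCount]
  refine Set.ncard_le_ncard ?_ (Set.toFinite _)
  intro m hm
  simp only [Finset.coe_image, Set.mem_image, Finset.mem_coe, Finset.mem_sigma,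
    Finset.mem_range] at hm
  obtain ⟨⟨j, i⟩, ⟨hj, hi⟩, rfl⟩ := hm
  dsimp only at hj hi ⊢
  have hij : i < j := hi.trans_le (hf j)
  refine ⟨s(⟨i, hij.trans hj⟩, ⟨j, hj⟩), ?_, ?_⟩
  · simp [Fin.ext_iff, hij.ne]
  · rw [backwardColouring_mk]
    simp only [max_eq_right hij.le, min_eq_left hij.le]
    rw [min_eq_left (Nat.le_sub_one_of_lt hi)]

lemma not_hasRainbowCopy_backwardColouring {V : Type*} [Fintype V] (H : SimpleGraph V)
    [DecidableRel H.Adj] (hδ : 2 ≤ H.minDegree) (n : ℕ) (f : ℕ → ℕ)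
    (hf : ∀ j, Fintype.card V ≤ j + 1 → f j < H.minDegree) :
    ¬ HasRainbowCopy (backwardColouring n f) H := by
  rintro ⟨g, hg⟩
  have hV : Nonempty V := by
    by_contra h
    rw [not_nonempty_iff] at h
    simp at hδ
  obtain ⟨u, hu⟩ := Finite.exists_max fun v => (g v).1
  have hcard : Fintype.card V ≤ (g u).1 + 1 := by
    have := Finset.card_le_card_of_injOn (s := Finset.univ) (t := Finset.range ((g u).1 + 1))
      (fun v => (g v).1) (fun v _ => by simpa [Nat.lt_succ_iff] using hu v)
      (fun v _ w _ h => g.injective (Fin.ext h))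
    simpa using this
  have hlt := hf _ hcard
  have hdeg := H.minDegree_le_degree u
  obtain ⟨v, hv, w, hw, hvw, h⟩ := Finset.exists_ne_map_eq_of_card_lt_of_maps_to
    (s := H.neighborFinset u) (t := Finset.range (H.minDegree - 1))
    (f := fun v => min (g v).1 (f (g u).1 - 1))
    (by rw [Finset.card_range, H.card_neighborFinset_eq_degree]; omega)
    (fun v _ => by simp only [Finset.coe_range, Set.mem_Iio]; omega)
  rw [H.mem_neighborFinset] at hv hw
  refine hg u v u w hv hw (fun h => hvw (Sym2.congr_right.1 h)) ?_
  rw [backwardColouring_mk, backwardColouring_mk]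
  simp only [max_eq_left (hu v), max_eq_left (hu w), min_eq_right (hu v), min_eq_right (hu w)]
  exact congrArg _ h

lemma colourCount_le_starAntiRamsey {V : Type*} (H : SimpleGraph V) {n : ℕ}
    {c : EdgeColouring (Fin n)} (hc : IsStarColouring c) (hH : ¬ HasRainbowCopy c H) :
    colourCount c ≤ starAntiRamsey n H := by
  refine le_csSup ⟨{e : Sym2 (Fin n) | ¬ e.IsDiag}.ncard, ?_⟩ ⟨c, hc, rfl, hH⟩
  rintro _ ⟨c', -, rfl, -⟩
  exact Set.ncard_image_le (Set.toFinite _)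

/-- For a graph `H` with minimum degree `δ(H) ≥ 2` and `n ≥ v(H)`,
`ar*(n, H) ≥ (v(H)-1 choose 2) + (δ(H)-1)(n - v(H) + 1)`. -/
theorem starAntiRamsey_minDegree_lower {V : Type*} [Fintype V]
    (H : SimpleGraph V) [DecidableRel H.Adj] (hδ : 2 ≤ H.minDegree)
    (n : ℕ) (hn : Fintype.card V ≤ n) :
    (Fintype.card V - 1).choose 2 + (H.minDegree - 1) * (n - Fintype.card V + 1)
      ≤ starAntiRamsey n H := by
  have hV : Nonempty V := by
    by_contra h
    rw [not_nonempty_iff] at h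
    simp at hδ
  obtain ⟨u⟩ := hV
  have hp : H.minDegree < Fintype.card V :=
    (H.minDegree_le_degree u).trans_lt (H.degree_lt_card_verts u)
  set p := Fintype.card V
  set d := H.minDegree
  let f : ℕ → ℕ := fun j => if j < p - 1 then j else d - 1
  have hf : ∀ j, f j ≤ j := fun j => by dsimp only [f]; split_ifs <;> omega
  have hsum : ∑ j ∈ Finset.range n, f j = (p - 1).choose 2 + (d - 1) * (n - p + 1) := by
    obtain ⟨k, rfl⟩ : ∃ k, n = (p - 1) + k := ⟨n - (p - 1), by omega⟩
    rw [Finset.sum_range_add]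
    congr 1
    · rw [Nat.choose_two_right, ← Finset.sum_range_id]
      exact Finset.sum_congr rfl fun j hj => if_pos (Finset.mem_range.1 hj)
    · have hk : p - 1 + k - p + 1 = k := by omega
      simp [f, hk, mul_comm]
  rw [← hsum]
  refine (sum_le_colourCount_backwardColouring n f hf).trans
    (colourCount_le_starAntiRamsey H (isStarColouring_backwardColouring n f)
      (not_hasRainbowCopy_backwardColouring H hδ n f fun j hj => ?_))
  dsimp only [f]
  split_ifs <;> omega
end
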